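/- The class 𝒞ₛ = {finite S-structures A with ∅ ≤ₛ A} with strong embeddings satisfies the amalgamation property: for A, B₁, B₂ ∈ 𝒞ₛ with A ≤ₛ B₁ and A ≤ₛ B₂, there exists D ∈ 𝒞ₛ and strong embeddings i: B₁ → D, j: B₂ → D with i∘(A↪B₁) = j∘(A↪B₂) and i(A) ≤ₛ D. -/

import Mathlib

variable {α : Type*} [DecidableEq α] {β : Type*} [DecidableEq β]

/-- `|X|* = max(0, |X| - 2)`. -/
def cardStar (X : Finset α) : ℤ := max 0 ((X.card : ℤ) - 2)

/-- An S-structure: a carrier set together with a pre-multiplicity function `pm` on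
finite sets (its support being the set of declared maximal cliques, each a subset of the
carrier of size `≥ 3`, with pre-multiplicity at most 3), such that every finite set meets
only finitely many cliques in `≥ 3` points, and the associated multiplicity function
`m(D) = Σ_{D ⊆ C} pm C` satisfies the validity bound `m(D)·(|D|-2) ≤ |D|`. -/
structure SStruct (α : Type*) [DecidableEq α] where
  carrier : Set α
  pm : Finset α → ℕ
  pm_le : ∀ C, pm C ≤ 3
  pm_supp : ∀ C, pm C ≠ 0 → ↑C ⊆ carrier ∧ 3 ≤ C.card
  finite_meets : ∀ X : Finset α, {C : Finset α | pm C ≠ 0 ∧ 3 ≤ (C ∩ X).card}.Finite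
  valid : ∀ D : Finset α, 3 ≤ D.card →
    (∑ᶠ C ∈ {C : Finset α | D ⊆ C}, pm C) * (D.card - 2) ≤ D.card

/-- The S-predimension of a finite subset `X` of the ambient S-structure `N`:
`d₀ₛ(X) = |X| - Σ_C pm(C)·|C ∩ X|*` (the induced cliques on `X` are the `C ∩ X`). -/
noncomputable def d0s (N : SStruct α) (X : Finset α) : ℤ :=
  (X.card : ℤ) - ∑ᶠ C : Finset α, (N.pm C : ℤ) * cardStar (C ∩ X)

/-- A finite subset `A` is strong (self-sufficient) in `B`: `d₀ₛ(X/A) ≥ 0` for every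
finite `X ⊆ B`. -/
def FinStrongIn (N : SStruct α) (A : Finset α) (B : Set α) : Prop :=
  ↑A ⊆ B ∧ ∀ X : Finset α, ↑X ⊆ B → d0s N A ≤ d0s N (X ∪ A)

/-- `A ≤ₛ B` for arbitrary (possibly infinite) subsets `A ⊆ B` of the ambient
S-structure `N`: every finite `D ⊆ A` strong in `A` is strong in `B`. -/
def StrongIn (N : SStruct α) (A B : Set α) : Prop :=
  A ⊆ B ∧ ∀ D : Finset α, ↑D ⊆ A → FinStrongIn N D A → FinStrongIn N D B

/-- The associated multiplicity function: `m(X) = Σ_{X ⊆ C} pm C`. -/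
noncomputable def multFun (N : SStruct α) (X : Finset α) : ℕ :=
  ∑ᶠ C ∈ {C : Finset α | X ⊆ C}, N.pm C

/-- `E ∈ 𝒞ₛ`: a finite S-structure all of whose substructures have nonnegative
S-predimension (`∅ ≤ₛ E`). -/
def InCs (E : SStruct α) : Prop :=
  E.carrier.Finite ∧ ∀ X : Finset α, ↑X ⊆ E.carrier → 0 ≤ d0s E X

/-- `A` is a substructure of `B`: the carriers are nested and the associated
multiplicity functions agree on finite subsets of `A` of size `≥ 3` (by the uniqueness
remark, the multiplicity function determines a finite S-structure). -/
def IsSubstruct (A B : SStruct α) : Prop :=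
  A.carrier ⊆ B.carrier ∧
  ∀ X : Finset α, ↑X ⊆ A.carrier → 3 ≤ X.card → multFun A X = multFun B X

/-- `f` is an embedding of the S-structure `A` into `D`: injective on the carrier,
mapping into the carrier of `D`, and preserving the multiplicity function (hence the
cliques and their multiplicities). -/
def IsEmbedding (A : SStruct α) (D : SStruct β) (f : α → β) : Prop :=
  Set.InjOn f A.carrier ∧ f '' A.carrier ⊆ D.carrier ∧
  ∀ X : Finset α, ↑X ⊆ A.carrier → 3 ≤ X.card →
    multFun D (X.image f) = multFun A X

/-- A (finite) subset `A` of the ambient S-structure `N` is strong in `B ⊆ N`. -/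
def FinStrongSet (N : SStruct β) (A B : Set β) : Prop :=
  A ⊆ B ∧ ∀ Y X : Finset β, ↑Y = A → ↑X ⊆ B → d0s N Y ≤ d0s N (X ∪ Y)

universe u

/-- The finite family `q` computes the predimension and the multiplicity function of `N`. -/
structure IsCliqueFamily {ι : Type*} [Fintype ι] (N : SStruct α) (q : ι → Finset α) : Prop where
  d0s_eq : ∀ X : Finset α, d0s N X = (X.card : ℤ) - ∑ i, cardStar (q i ∩ X)
  multFun_eq : ∀ X : Finset α, 3 ≤ X.card →
    multFun N X = (Finset.univ.filter fun i => X ⊆ q i).card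

theorem finsum_mem_count_superset {ι : Type*} [Fintype ι] (q : ι → Finset α) (X : Finset α) :
    (∑ᶠ C ∈ {C : Finset α | X ⊆ C}, (Finset.univ.filter fun i => q i = C).card) =
      (Finset.univ.filter fun i => X ⊆ q i).card := by
  rw [finsum_mem_eq_sum_of_inter_support_eq (t := (Finset.univ.image q).filter (X ⊆ ·))]
  · rw [Finset.card_eq_sum_card_fiberwise (f := q) (t := (Finset.univ.image q).filter (X ⊆ ·))]
    · refine Finset.sum_congr rfl fun C hC => ?_
      congr 1
      ext i
      simp only [Finset.mem_filter, Finset.mem_univ, true_and] at hC ⊢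
      constructor
      · rintro rfl
        exact ⟨hC.2, rfl⟩
      · exact fun h => h.2
    · intro i hi
      simpa using hi
  · ext C
    simp only [Set.mem_inter_iff, Set.mem_ofPred_eq, Function.mem_support, Finset.coe_filter,
      Finset.mem_image, Finset.mem_univ, true_and, ne_eq, Finset.card_eq_zero,
      Finset.filter_eq_empty_iff, not_forall, not_not]
    constructor
    · rintro ⟨h, i, hi⟩
      exact ⟨⟨⟨i, by simpa using hi⟩, h⟩, i, by simpa using hi⟩
    · rintro ⟨⟨-, h⟩, i, hi⟩
      exact ⟨h, i, by simpa using hi⟩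

theorem isCliqueFamily_of_count {ι : Type*} [Fintype ι] {N : SStruct α} {q : ι → Finset α}
    (h : ∀ C, N.pm C = (Finset.univ.filter fun i => q i = C).card) : IsCliqueFamily N q where
  d0s_eq X := by
    unfold d0s
    rw [finsum_eq_sum_of_support_subset (s := Finset.univ.image q)]
    · rw [Finset.sum_comp (fun C => cardStar (C ∩ X)) q]
      simp [h]
    · intro C hC
      by_contra hne
      apply hC
      have : N.pm C = 0 := by
        rw [h, Finset.card_eq_zero, Finset.filter_eq_empty_iff]
        intro i _ hi
        exact hne (by simp [← hi])
      simp [this]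
  multFun_eq X _ := by
    unfold multFun
    simp only [h]
    exact finsum_mem_count_superset q X

theorem exists_count_eq_pm (N : SStruct α) (hN : N.carrier.Finite) :
    ∃ (s : Finset (Finset α)) (q : (Σ C : s, Fin (N.pm C)) → Finset α),
      ∀ C, N.pm C = (Finset.univ.filter fun i => q i = C).card := by
  refine ⟨hN.toFinset.powerset, fun i => i.1, fun C => ?_⟩
  rw [Finset.card_filter, Fintype.sum_sigma]
  have h : ∀ D : hN.toFinset.powerset,
      (∑ _ : Fin (N.pm D), if D.1 = C then 1 else 0) = if D.1 = C then N.pm D else 0 := by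
    intro D
    split_ifs <;> simp
  rw [Finset.sum_congr rfl fun D _ => h D]
  rw [Finset.sum_coe_sort hN.toFinset.powerset (fun D => if D = C then N.pm D else 0),
    Finset.sum_ite_eq']
  split_ifs with hC
  · rfl
  · by_contra h
    apply hC
    simpa [Finset.mem_powerset, ← Finset.coe_subset] using (N.pm_supp C h).1

/-- The S-structure whose cliques are the members of a finite family. -/
def SStruct.ofFamily {ι : Type*} [Fintype ι] (S : Set α) (q : ι → Finset α)
    (hS : ∀ i, ↑(q i) ⊆ S) (hcard : ∀ i, 3 ≤ (q i).card)
    (hvalid : ∀ X : Finset α, 3 ≤ X.card →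
      (Finset.univ.filter fun i => X ⊆ q i).card * (X.card - 2) ≤ X.card) : SStruct α where
  carrier := S
  pm C := (Finset.univ.filter fun i => q i = C).card
  pm_le C := by
    by_cases hC : 3 ≤ C.card
    · have h1 := hvalid C hC
      have h2 : (Finset.univ.filter fun i => q i = C).card ≤
          (Finset.univ.filter fun i => C ⊆ q i).card :=
        Finset.card_le_card fun i => by
          simp only [Finset.mem_filter, Finset.mem_univ, true_and]
          rintro rfl
          exact subset_rfl
      by_contra! h
      obtain ⟨k, hk⟩ := Nat.exists_eq_add_of_le hC
      have h3 : 3 + k - 2 = k + 1 := by omega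
      rw [hk, h3] at h1
      nlinarith
    · rw [Finset.filter_false_of_mem]
      · simp
      · rintro i - rfl
        exact hC (hcard i)
  pm_supp C h := by
    obtain ⟨i, hi⟩ := Finset.card_ne_zero.mp h
    obtain rfl : q i = C := by simpa using hi
    exact ⟨hS i, hcard i⟩
  finite_meets X := by
    refine (Finset.univ.image q).finite_toSet.subset ?_
    rintro C ⟨h, -⟩
    obtain ⟨i, hi⟩ := Finset.card_ne_zero.mp h
    have : q i = C := by simpa using hi
    simp [← this]
  valid X hX := by
    rw [finsum_mem_count_superset]
    exact hvalid X hX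

theorem SStruct.isCliqueFamily_ofFamily {ι : Type*} [Fintype ι] (S : Set α) (q : ι → Finset α)
    (hS : ∀ i, ↑(q i) ⊆ S) (hcard : ∀ i, 3 ≤ (q i).card)
    (hvalid : ∀ X : Finset α, 3 ≤ X.card →
      (Finset.univ.filter fun i => X ⊆ q i).card * (X.card - 2) ≤ X.card) :
    IsCliqueFamily (SStruct.ofFamily S q hS hcard hvalid) q :=
  isCliqueFamily_of_count fun _ => rfl

theorem cardStar_supermodular (C X Y : Finset α) :
    cardStar (C ∩ X) + cardStar (C ∩ Y) ≤ cardStar (C ∩ (X ∪ Y)) + cardStar (C ∩ (X ∩ Y)) := by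
  have h1 := Finset.card_union_add_card_inter (C ∩ X) (C ∩ Y)
  rw [← Finset.inter_union_distrib_left, ← Finset.inter_inter_distrib_left] at h1
  have h2 : (C ∩ (X ∩ Y)).card ≤ (C ∩ X).card :=
    Finset.card_le_card (Finset.inter_subset_inter_left Finset.inter_subset_left)
  have h3 : (C ∩ (X ∩ Y)).card ≤ (C ∩ Y).card :=
    Finset.card_le_card (Finset.inter_subset_inter_left Finset.inter_subset_right)
  unfold cardStar
  omega

theorem cardStar_mono {γ : Type*} {X Y : Finset γ} (h : X ⊆ Y) : cardStar X ≤ cardStar Y := by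
  have := Finset.card_le_card h
  unfold cardStar
  omega

theorem cardStar_eq_zero {γ : Type*} {X : Finset γ} (h : X.card < 3) : cardStar X = 0 := by
  unfold cardStar
  omega

theorem image_subset_iff_of_mem_iff {γ : Type*} {s : Finset γ} {t : Finset β} {f : γ → β}
    (h : ∀ a, f a ∈ t ↔ a ∈ s) (X : Finset γ) : X.image f ⊆ t ↔ X ⊆ s := by
  rw [Finset.image_subset_iff]
  exact forall₂_congr fun a _ => h a

namespace IsCliqueFamily

variable {ι : Type*} [Fintype ι]

theorem d0s_submodular {N : SStruct α} {q : ι → Finset α} (hq : IsCliqueFamily N q)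
    (X Y : Finset α) : d0s N (X ∪ Y) + d0s N (X ∩ Y) ≤ d0s N X + d0s N Y := by
  simp only [hq.d0s_eq]
  have h1 := Finset.card_union_add_card_inter X Y
  have h2 := Finset.sum_le_sum fun i (_ : i ∈ Finset.univ) => cardStar_supermodular (q i) X Y
  simp only [Finset.sum_add_distrib] at h2
  omega

theorem d0s_inter_le {N : SStruct α} {q : ι → Finset α} (hq : IsCliqueFamily N q)
    {X S : Finset α} (h : d0s N S ≤ d0s N (X ∪ S)) : d0s N (X ∩ S) ≤ d0s N X := by
  have := hq.d0s_submodular X S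
  omega

theorem d0s_image {N : SStruct α} {M : SStruct β} {p : ι → Finset α} {c : ι → Finset β}
    (hp : IsCliqueFamily N p) (hc : IsCliqueFamily M c) {f : α → β}
    (hf : Function.Injective f) (hfc : ∀ i a, f a ∈ c i ↔ a ∈ p i) (X : Finset α) :
    d0s M (X.image f) = d0s N X := by
  rw [hp.d0s_eq, hc.d0s_eq, Finset.card_image_of_injective X hf]
  congr 1
  refine Finset.sum_congr rfl fun i _ => ?_
  have : c i ∩ X.image f = (p i ∩ X).image f := by
    ext b
    simp only [Finset.mem_inter, Finset.mem_image]
    constructor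
    · rintro ⟨h, a, ha, rfl⟩
      exact ⟨a, ⟨(hfc i a).1 h, ha⟩, rfl⟩
    · rintro ⟨a, ⟨h, ha⟩, rfl⟩
      exact ⟨(hfc i a).2 h, a, ha, rfl⟩
  rw [this, cardStar, cardStar, Finset.card_image_of_injective _ hf]

theorem multFun_image {N : SStruct α} {M : SStruct β} {p : ι → Finset α} {c : ι → Finset β}
    (hp : IsCliqueFamily N p) (hc : IsCliqueFamily M c) {f : α → β}
    (hf : Function.Injective f) (hfc : ∀ i a, f a ∈ c i ↔ a ∈ p i) (X : Finset α)
    (hX : 3 ≤ X.card) : multFun M (X.image f) = multFun N X := by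
  rw [hp.multFun_eq X hX,
    hc.multFun_eq _ (by rwa [Finset.card_image_of_injective X hf])]
  simp only [image_subset_iff_of_mem_iff (hfc _)]

theorem valid {N : SStruct α} {q : ι → Finset α} (hq : IsCliqueFamily N q)
    (X : Finset α) (hX : 3 ≤ X.card) :
    (Finset.univ.filter fun i => X ⊆ q i).card * (X.card - 2) ≤ X.card := by
  rw [← hq.multFun_eq X hX]
  exact N.valid X hX

/-- A point over a strong set lies in at most one clique meeting that set in at least two
points. -/
theorem eq_of_mem_of_strong {N : SStruct α} {q : ι → Finset α} (hq : IsCliqueFamily N q)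
    {S : Finset α} {x : α} (hx : x ∉ S) (h : d0s N S ≤ d0s N ({x} ∪ S)) {i j : ι}
    (hi : 2 ≤ (q i ∩ S).card) (hj : 2 ≤ (q j ∩ S).card) (hxi : x ∈ q i) (hxj : x ∈ q j) :
    i = j := by
  classical
  by_contra hij
  have step : ∀ k, 2 ≤ (q k ∩ S).card → x ∈ q k →
      cardStar (q k ∩ ({x} ∪ S)) - cardStar (q k ∩ S) = 1 := by
    intro k hk hxk
    have : q k ∩ ({x} ∪ S) = insert x (q k ∩ S) := by
      ext y
      simp only [Finset.mem_inter, Finset.mem_union, Finset.mem_singleton, Finset.mem_insert]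
      constructor
      · tauto
      · rintro (rfl | h)
        · exact ⟨hxk, Or.inl rfl⟩
        · exact ⟨h.1, Or.inr h.2⟩
    rw [this, cardStar, cardStar, Finset.card_insert_of_notMem (by simp [hx])]
    omega
  have hsum : (∑ k ∈ {i, j}, (cardStar (q k ∩ ({x} ∪ S)) - cardStar (q k ∩ S))) ≤
      ∑ k, (cardStar (q k ∩ ({x} ∪ S)) - cardStar (q k ∩ S)) :=
    Finset.sum_le_sum_of_subset_of_nonneg (Finset.subset_univ _) fun k _ _ =>
      sub_nonneg.2 (cardStar_mono (Finset.inter_subset_inter_left Finset.subset_union_right))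
  rw [Finset.sum_pair hij, step i hi hxi, step j hj hxj, Finset.sum_sub_distrib] at hsum
  rw [hq.d0s_eq, hq.d0s_eq, ← Finset.insert_eq, Finset.card_insert_of_notMem hx,
    Finset.insert_eq] at h
  push_cast at h
  omega

/-- Reindexing a clique family, padding it with sets of size less than `3`. -/
theorem of_injective {κ : Type*} [Fintype κ] {N : SStruct α} {q : ι → Finset α}
    (hq : IsCliqueFamily N q) {p : κ → Finset α} {φ : ι → κ} (hφ : Function.Injective φ)
    (hp : ∀ i, p (φ i) = q i) (hsmall : ∀ k, k ∉ Set.range φ → (p k).card < 3) :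
    IsCliqueFamily N p where
  d0s_eq X := by
    rw [hq.d0s_eq]
    congr 1
    refine Fintype.sum_of_injective φ hφ _ _ (fun k hk => cardStar_eq_zero ?_) fun i => by rw [hp]
    exact (Finset.card_le_card Finset.inter_subset_left).trans_lt (hsmall k hk)
  multFun_eq X hX := by
    rw [hq.multFun_eq X hX, Finset.card_filter, Finset.card_filter]
    refine Fintype.sum_of_injective φ hφ _ _ (fun k hk => if_neg fun hXk => ?_)
      fun i => by rw [hp]
    have := Finset.card_le_card hXk
    have := hsmall k hk
    omega

end IsCliqueFamily

theorem cardStar_free_amalgam {C U V Z : Finset α} (hZ : Z ⊆ V)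
    (hC : 3 ≤ (C ∩ (U ∩ V)).card ∨ C ⊆ U ∨ C ⊆ V) :
    cardStar (C ∩ (Z ∪ U)) + cardStar (C ∩ (U ∩ V)) =
      cardStar (C ∩ (Z ∪ (U ∩ V))) + cardStar (C ∩ U) := by
  rcases hC with hC | hC | hC
  · have h1 : C ∩ (Z ∪ U) = C ∩ (Z \ U) ∪ C ∩ U := by grind
    have h2 : C ∩ (Z ∪ (U ∩ V)) = C ∩ (Z \ U) ∪ C ∩ (U ∩ V) := by grind
    have h3 : (C ∩ (Z ∪ U)).card = (C ∩ (Z \ U)).card + (C ∩ U).card := by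
      rw [h1, Finset.card_union_of_disjoint]
      rw [Finset.disjoint_left]
      grind
    have h4 : (C ∩ (Z ∪ (U ∩ V))).card = (C ∩ (Z \ U)).card + (C ∩ (U ∩ V)).card := by
      rw [h2, Finset.card_union_of_disjoint]
      rw [Finset.disjoint_left]
      grind
    have h5 : (C ∩ (U ∩ V)).card ≤ (C ∩ U).card :=
      Finset.card_le_card (Finset.inter_subset_inter_left Finset.inter_subset_left)
    unfold cardStar
    omega
  · have h1 : C ∩ (Z ∪ U) = C ∩ U := by grind
    have h2 : C ∩ (Z ∪ (U ∩ V)) = C ∩ (U ∩ V) := by grind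
    rw [h1, h2, add_comm]
  · have h1 : C ∩ U = C ∩ (U ∩ V) := by grind
    have h2 : C ∩ (Z ∪ U) = C ∩ (Z ∪ (U ∩ V)) := by grind
    rw [h1, h2]

/-- In a free amalgam of `U` and `V`, strength of `U ∩ V` in `V` passes to `U`. -/
theorem IsCliqueFamily.d0s_le_of_free_amalgam {ι : Type*} [Fintype ι] {N : SStruct α}
    {q : ι → Finset α} (hq : IsCliqueFamily N q) {U V : Finset α}
    (hfree : ∀ i, 3 ≤ (q i ∩ (U ∩ V)).card ∨ q i ⊆ U ∨ q i ⊆ V)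
    (hV : ∀ Z ⊆ V, d0s N (U ∩ V) ≤ d0s N (Z ∪ (U ∩ V)))
    {X : Finset α} (hX : X ⊆ U ∪ V) : d0s N U ≤ d0s N (X ∪ U) := by
  have hXU : X ∪ U = X ∩ V ∪ U := by grind
  have h := hV (X ∩ V) Finset.inter_subset_right
  rw [hXU]
  simp only [hq.d0s_eq] at h ⊢
  have hs := Finset.sum_congr rfl fun i (_ : i ∈ Finset.univ) =>
    cardStar_free_amalgam (C := q i) (Finset.inter_subset_right (s₁ := X) (s₂ := V)) (hfree i)
  simp only [Finset.sum_add_distrib] at hs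
  have h1 : ((X ∩ V) ∪ U).card = ((X ∩ V) \ U).card + U.card := by
    rw [← Finset.card_union_of_disjoint Finset.sdiff_disjoint, Finset.sdiff_union_self_eq_union]
  have h2 : ((X ∩ V) ∪ (U ∩ V)).card = ((X ∩ V) \ U).card + (U ∩ V).card := by
    rw [← Finset.card_union_of_disjoint]
    · congr 1
      grind
    · rw [Finset.disjoint_left]
      grind
  omega

theorem card_superset_eq_card_fiber_add {ι : Type*} [Fintype ι] {S : Finset α}
    {s : ι → Finset α} (hs : ∀ i, s i ⊆ S) (X : Finset α) :
    (Finset.univ.filter fun i => X ⊆ s i).card =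
      (Finset.univ.filter fun i => s i = X).card +
        ∑ Y ∈ S.powerset.filter (X ⊂ ·), (Finset.univ.filter fun i => s i = Y).card := by
  classical
  have h1 : (Finset.univ.filter fun i => X ⊆ s i) =
      (Finset.univ.filter fun i => s i = X) ∪ (Finset.univ.filter fun i => X ⊂ s i) := by
    ext i
    simp only [Finset.mem_filter, Finset.mem_union, Finset.mem_univ, true_and]
    rw [subset_iff_ssubset_or_eq, eq_comm, or_comm]
  rw [h1, Finset.card_union_of_disjoint]
  · congr 1
    rw [Finset.card_eq_sum_card_fiberwise (f := s) (t := S.powerset.filter (X ⊂ ·))]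
    · refine Finset.sum_congr rfl fun C hC => ?_
      congr 1
      ext i
      simp only [Finset.mem_filter, Finset.mem_univ, true_and] at hC ⊢
      constructor
      · exact fun h => h.2
      · rintro rfl
        exact ⟨hC.2, rfl⟩
    · intro i hi
      simpa [hs i] using hi
  · rw [Finset.disjoint_left]
    intro i hi hi'
    simp only [Finset.mem_filter, Finset.mem_univ, true_and] at hi hi'
    exact hi'.ne hi.symm

/-- Möbius inversion: the number of occurrences of a set of size `≥ 3` in a family is determined
by the numbers of members containing each such set. -/
theorem card_fiber_eq_of_card_superset_eq {ι κ : Type*} [Fintype ι] [Fintype κ] {S : Finset α}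
    {s : ι → Finset α} {t : κ → Finset α} (hs : ∀ i, s i ⊆ S) (ht : ∀ k, t k ⊆ S)
    (h : ∀ X ⊆ S, 3 ≤ X.card → (Finset.univ.filter fun i => X ⊆ s i).card =
      (Finset.univ.filter fun k => X ⊆ t k).card)
    (X : Finset α) (hXS : X ⊆ S) (hX : 3 ≤ X.card) :
    (Finset.univ.filter fun i => s i = X).card = (Finset.univ.filter fun k => t k = X).card := by
  induction hn : S.card - X.card using Nat.strong_induction_on generalizing X with
  | _ n ih =>
    have h1 := h X hXS hX
    rw [card_superset_eq_card_fiber_add hs, card_superset_eq_card_fiber_add ht] at h1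
    have h2 : ∑ Y ∈ S.powerset.filter (X ⊂ ·), (Finset.univ.filter fun i => s i = Y).card =
        ∑ Y ∈ S.powerset.filter (X ⊂ ·), (Finset.univ.filter fun k => t k = Y).card := by
      refine Finset.sum_congr rfl fun Y hY => ?_
      rw [Finset.mem_filter, Finset.mem_powerset] at hY
      have h3 := Finset.card_lt_card hY.2
      have h4 := Finset.card_le_card hY.1
      exact ih (S.card - Y.card) (by omega) Y hY.1 (by omega) rfl
    omega

theorem exists_isCliqueFamily (N : SStruct α) (hN : N.carrier.Finite) :
    ∃ (s : Finset (Finset α)) (q : (Σ C : s, Fin (N.pm C)) → Finset α),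
      IsCliqueFamily N q ∧ ∀ i, ↑(q i) ⊆ N.carrier ∧ 3 ≤ (q i).card := by
  obtain ⟨s, q, hq⟩ := exists_count_eq_pm N hN
  refine ⟨s, q, isCliqueFamily_of_count hq, fun i => N.pm_supp _ ?_⟩
  rw [hq, Finset.card_ne_zero]
  exact ⟨i, by simp⟩

/-- Two families with the same numbers of supersets can be matched along sets of size `≥ 3`. -/
theorem exists_equiv_of_card_superset_eq {ι κ : Type*} [Fintype ι] [Fintype κ] {S : Finset α}
    {s : ι → Finset α} {t : κ → Finset α} (hs : ∀ i, s i ⊆ S) (ht : ∀ k, t k ⊆ S)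
    (h : ∀ X ⊆ S, 3 ≤ X.card → (Finset.univ.filter fun i => X ⊆ s i).card =
      (Finset.univ.filter fun k => X ⊆ t k).card) :
    ∃ e : {i // 3 ≤ (s i).card} ≃ {k // 3 ≤ (t k).card}, ∀ i, t (e i) = s i := by
  have key : ∀ X : Finset α, Nonempty
      ({a : {i // 3 ≤ (s i).card} // s a = X} ≃ {b : {k // 3 ≤ (t k).card} // t b = X}) := by
    intro X
    by_cases hX : 3 ≤ X.card ∧ X ⊆ S
    · have h1 := card_fiber_eq_of_card_superset_eq hs ht h X hX.2 hX.1
      rw [← Fintype.card_subtype, ← Fintype.card_subtype] at h1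
      exact ⟨(Equiv.subtypeSubtypeEquivSubtype fun {i} hi => by rw [hi]; exact hX.1).trans
        ((Fintype.equivOfCardEq h1).trans
          (Equiv.subtypeSubtypeEquivSubtype fun {i} hi => by rw [hi]; exact hX.1).symm)⟩
    · have h1 : IsEmpty {a : {i // 3 ≤ (s i).card} // s a = X} :=
        ⟨fun a => hX (a.2 ▸ ⟨a.1.2, hs _⟩)⟩
      have h2 : IsEmpty {b : {k // 3 ≤ (t k).card} // t b = X} :=
        ⟨fun a => hX (a.2 ▸ ⟨a.1.2, ht _⟩)⟩
      exact ⟨Equiv.equivOfIsEmpty _ _⟩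
  exact ⟨Equiv.ofFiberEquiv (f := fun a : {i // 3 ≤ (s i).card} => s a)
    (g := fun b : {k // 3 ≤ (t k).card} => t b) fun X => (key X).some,
    fun i => Equiv.ofFiberEquiv_map (f := fun a : {i // 3 ≤ (s i).card} => s a)
      (g := fun b : {k // 3 ≤ (t k).card} => t b) (fun X => (key X).some) i⟩

/-- The cliques of two S-structures can be paired along a common substructure. -/
theorem exists_paired_cliqueFamily {α : Type u} [DecidableEq α] (B1 B2 : SStruct α)
    (hB1 : B1.carrier.Finite) (hB2 : B2.carrier.Finite) (S : Finset α)
    (hS1 : ↑S ⊆ B1.carrier) (hS2 : ↑S ⊆ B2.carrier)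
    (h : ∀ X ⊆ S, 3 ≤ X.card → multFun B1 X = multFun B2 X) :
    ∃ (ι : Type u) (_ : Fintype ι) (p1 p2 : ι → Finset α),
      IsCliqueFamily B1 p1 ∧ IsCliqueFamily B2 p2 ∧
      ∀ i, (p1 i : Set α) ⊆ B1.carrier ∧ (p2 i : Set α) ⊆ B2.carrier ∧ p1 i ∩ S = p2 i ∩ S ∧
        (3 ≤ (p1 i).card ∨ 3 ≤ (p2 i).card) ∧
        (3 ≤ (p1 i ∩ S).card ∨ p1 i ⊆ S ∨ p2 i ⊆ S) := by
  obtain ⟨s1, q1, hq1, hc1⟩ := exists_isCliqueFamily B1 hB1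
  obtain ⟨s2, q2, hq2, hc2⟩ := exists_isCliqueFamily B2 hB2
  have hS : ∀ {ν : Type u} (r : ν → Finset α), ∀ X ⊆ S, ∀ i, X ⊆ r i ∩ S ↔ X ⊆ r i :=
    fun r X hX i => ⟨fun h => h.trans Finset.inter_subset_left,
      fun h => Finset.subset_inter h hX⟩
  obtain ⟨e, he⟩ := exists_equiv_of_card_superset_eq (S := S) (s := fun i => q1 i ∩ S)
    (t := fun k => q2 k ∩ S) (fun _ => Finset.inter_subset_right)
    (fun _ => Finset.inter_subset_right) (by
      intro X hXS hX
      simp only [hS _ X hXS]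
      rw [← hq1.multFun_eq X hX, ← hq2.multFun_eq X hX, h X hXS hX])
  refine ⟨{i // 3 ≤ (q1 i ∩ S).card} ⊕ {i // ¬ 3 ≤ (q1 i ∩ S).card} ⊕
      {k // ¬ 3 ≤ (q2 k ∩ S).card}, inferInstance,
    Sum.elim (fun i => q1 i) (Sum.elim (fun i => q1 i) fun k => q2 k ∩ S),
    Sum.elim (fun i => q2 (e i)) (Sum.elim (fun i => q1 i ∩ S) fun k => q2 k), ?_, ?_, ?_⟩
  · refine hq1.of_injective (φ := fun i => if hi : 3 ≤ (q1 i ∩ S).card then Sum.inl ⟨i, hi⟩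
      else Sum.inr (Sum.inl ⟨i, hi⟩)) ?_ ?_ ?_
    · intro i j hij
      grind
    · intro i
      split_ifs <;> rfl
    · rintro (i | i | k) hk
      · exact absurd ⟨i.1, dif_pos i.2⟩ hk
      · exact absurd ⟨i.1, dif_neg i.2⟩ hk
      · exact not_le.1 k.2
  · refine hq2.of_injective (φ := fun k => if hk : 3 ≤ (q2 k ∩ S).card
      then Sum.inl (e.symm ⟨k, hk⟩) else Sum.inr (Sum.inr ⟨k, hk⟩)) ?_ ?_ ?_
    · intro i j hij
      dsimp only at hij
      split_ifs at hij
      · simpa using hij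
      · simpa using hij
    · intro i
      split_ifs <;> simp
    · rintro (i | i | k) hk
      · exact absurd ⟨(e i).1, by simp [dif_pos (e i).2]⟩ hk
      · exact not_le.1 i.2
      · exact absurd ⟨k.1, dif_neg k.2⟩ hk
  · rintro (i | i | k)
    · exact ⟨(hc1 _).1, (hc2 _).1, (he i).symm, Or.inl (hc1 _).2, Or.inl i.2⟩
    · refine ⟨(hc1 _).1, ?_, by simp, Or.inl (hc1 _).2, Or.inr (Or.inr Finset.inter_subset_right)⟩
      exact (Finset.coe_subset.2 Finset.inter_subset_right).trans hS2
    · refine ⟨?_, (hc2 _).1, by simp, Or.inr (hc2 _).2, Or.inr (Or.inl Finset.inter_subset_right)⟩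
      exact (Finset.coe_subset.2 Finset.inter_subset_right).trans hS1

/-- the class `𝒞ₛ` with strong embeddings has the amalgamation property:
given `A, B₁, B₂ ∈ 𝒞ₛ` with `A ≤ₛ B₁` and `A ≤ₛ B₂`, there are `D ∈ 𝒞ₛ` and strong
embeddings `i : B₁ → D`, `j : B₂ → D` agreeing on `A`, with `i(A) ≤ₛ D`. -/
theorem stmt13 (A B1 B2 : SStruct α)
    (hA : InCs A) (hB1 : InCs B1) (hB2 : InCs B2)
    (hsub1 : IsSubstruct A B1) (hsub2 : IsSubstruct A B2)
    (hst1 : FinStrongSet B1 A.carrier B1.carrier)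
    (hst2 : FinStrongSet B2 A.carrier B2.carrier) :
    ∃ (D : SStruct (α ⊕ α)) (i j : α → α ⊕ α),
      InCs D ∧
      IsEmbedding B1 D i ∧ IsEmbedding B2 D j ∧
      FinStrongSet D (i '' B1.carrier) D.carrier ∧
      FinStrongSet D (j '' B2.carrier) D.carrier ∧
      (∀ a ∈ A.carrier, i a = j a) ∧
      FinStrongSet D (i '' A.carrier) D.carrier := by
  set S := hA.1.toFinset with hSdef
  set U1 := hB1.1.toFinset with hU1def
  set V1 := hB2.1.toFinset with hV1def
  have hSA : (S : Set α) = A.carrier := by simp [hSdef]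
  have hU1 : (U1 : Set α) = B1.carrier := by simp [hU1def]
  have hV1 : (V1 : Set α) = B2.carrier := by simp [hV1def]
  have hSU : S ⊆ U1 := by rw [← Finset.coe_subset, hSA, hU1]; exact hsub1.1
  have hSV : S ⊆ V1 := by rw [← Finset.coe_subset, hSA, hV1]; exact hsub2.1
  obtain ⟨ι, _, p1, p2, hp1, hp2, hp⟩ := exists_paired_cliqueFamily B1 B2 hB1.1 hB2.1 S
    (hSA ▸ hsub1.1) (hSA ▸ hsub2.1) (by
      intro X hXS hX
      have hXA : (X : Set α) ⊆ A.carrier := by rw [← hSA]; exact_mod_cast hXS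
      rw [← hsub1.2 X hXA hX, hsub2.2 X hXA hX])
  have htrace : ∀ i, ∀ a ∈ S, (a ∈ p1 i ↔ a ∈ p2 i) := fun i a ha => by
    have := congrArg (a ∈ ·) (hp i).2.2.1
    simpa [ha] using this
  let j : α → α ⊕ α := fun a => if a ∈ S then Sum.inl a else Sum.inr a
  have hjS : ∀ a ∈ S, j a = Sum.inl a := fun a ha => if_pos ha
  have hjnS : ∀ a, a ∉ S → j a = Sum.inr a := fun a ha => if_neg ha
  have hi : Function.Injective (Sum.inl : α → α ⊕ α) := Sum.inl_injective
  have hj : Function.Injective j := by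
    intro a b hab
    grind
  let c : ι → Finset (α ⊕ α) := fun i => (p1 i).image Sum.inl ∪ (p2 i).image j
  have hcl : ∀ i a, Sum.inl a ∈ c i ↔ a ∈ p1 i := by
    intro i a
    simp only [c, Finset.mem_union, Finset.mem_image, Sum.inl.injEq, exists_eq_right]
    refine ⟨?_, Or.inl⟩
    rintro (h | ⟨b, hb, hab⟩)
    · exact h
    · by_cases hbS : b ∈ S
      · rw [hjS b hbS, Sum.inl.injEq] at hab
        exact hab ▸ (htrace i b hbS).2 hb
      · simp [hjnS b hbS] at hab
  have hcj : ∀ i a, j a ∈ c i ↔ a ∈ p2 i := by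
    intro i a
    by_cases haS : a ∈ S
    · rw [hjS a haS, hcl, htrace i a haS]
    · rw [Finset.mem_union, hj.mem_finset_image, or_iff_right]
      simp [hjnS a haS]
  set U := U1.image (Sum.inl : α → α ⊕ α) with hU
  set V := V1.image j with hV
  have hSj : S.image (Sum.inl : α → α ⊕ α) = S.image j :=
    Finset.image_congr fun a ha => (hjS a ha).symm
  have hUV : U ∩ V = S.image Sum.inl := by
    ext b
    simp only [hU, hV, Finset.mem_inter, Finset.mem_image]
    constructor
    · rintro ⟨⟨a, ha, rfl⟩, b, hb, hab⟩
      by_cases hbS : b ∈ S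
      · exact ⟨b, hbS, (hjS b hbS).symm.trans hab⟩
      · simp [hjnS b hbS] at hab
    · rintro ⟨a, ha, rfl⟩
      exact ⟨⟨a, hSU ha, rfl⟩, a, hSV ha, hjS a ha⟩
  have hp1U : ∀ i, p1 i ⊆ U1 := fun i => by
    rw [← Finset.coe_subset, hU1]
    exact (hp i).1
  have hp2V : ∀ i, p2 i ⊆ V1 := fun i => by
    rw [← Finset.coe_subset, hV1]
    exact (hp i).2.1
  have hcUV : ∀ i, c i ⊆ U ∪ V := fun i =>
    Finset.union_subset_union (Finset.image_subset_image (hp1U i))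
      (Finset.image_subset_image (hp2V i))
  have hfree : ∀ i, 3 ≤ (c i ∩ (U ∩ V)).card ∨ c i ⊆ U ∨ c i ⊆ V := by
    intro i
    rcases (hp i).2.2.2.2 with h | h | h
    · left
      rw [← Finset.card_image_of_injective _ hi] at h
      refine h.trans (Finset.card_le_card ?_)
      rw [hUV, Finset.image_inter _ _ hi]
      exact Finset.inter_subset_inter_right Finset.subset_union_left
    · right; right
      refine Finset.union_subset ?_ (Finset.image_subset_image (hp2V i))
      rw [Finset.image_subset_iff]
      exact fun a ha => Finset.mem_image.2 ⟨a, hSV (h ha), hjS a (h ha)⟩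
    · right; left
      refine Finset.union_subset (Finset.image_subset_image (hp1U i)) ?_
      rw [Finset.image_subset_iff]
      exact fun a ha => Finset.mem_image.2 ⟨a, hSU (h ha), (hjS a (h ha)).symm⟩
  have hstrong1 : ∀ Z ⊆ U1, d0s B1 S ≤ d0s B1 (Z ∪ S) := fun Z hZ =>
    hst1.2 S Z hSA (by rw [← hU1]; exact_mod_cast hZ)
  have hstrong2 : ∀ Z ⊆ V1, d0s B2 S ≤ d0s B2 (Z ∪ S) := fun Z hZ =>
    hst2.2 S Z hSA (by rw [← hV1]; exact_mod_cast hZ)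
  have hcard : ∀ i, 3 ≤ (c i).card := by
    intro i
    rcases (hp i).2.2.2.1 with h | h
    · rw [← Finset.card_image_of_injective _ hi] at h
      exact h.trans (Finset.card_le_card Finset.subset_union_left)
    · rw [← Finset.card_image_of_injective _ hj] at h
      exact h.trans (Finset.card_le_card Finset.subset_union_right)
  have hvalid : ∀ X : Finset (α ⊕ α), 3 ≤ X.card →
      (Finset.univ.filter fun i => X ⊆ c i).card * (X.card - 2) ≤ X.card := by
    intro X hX
    by_cases hXl : ∃ X' : Finset α, X'.image Sum.inl = X
    · obtain ⟨X', rfl⟩ := hXl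
      simp only [image_subset_iff_of_mem_iff (hcl _)]
      rw [Finset.card_image_of_injective _ hi] at hX ⊢
      exact hp1.valid X' hX
    by_cases hXj : ∃ X' : Finset α, X'.image j = X
    · obtain ⟨X', rfl⟩ := hXj
      simp only [image_subset_iff_of_mem_iff (hcj _)]
      rw [Finset.card_image_of_injective _ hj] at hX ⊢
      exact hp2.valid X' hX
    have hle : (Finset.univ.filter fun i => X ⊆ c i).card ≤ 1 := by
      rw [Finset.card_le_one]
      intro i hi' k hk'
      simp only [Finset.mem_filter, Finset.mem_univ, true_and] at hi' hk'
      have hx : ∃ x ∈ X, x ∉ V := by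
        by_contra! h
        obtain ⟨X', -, hX'⟩ := Finset.subset_image_iff.1 (show X ⊆ V1.image j from h)
        exact hXj ⟨X', hX'⟩
      have hy : ∃ y ∈ X, y ∉ U := by
        by_contra! h
        obtain ⟨X', -, hX'⟩ := Finset.subset_image_iff.1 (show X ⊆ U1.image Sum.inl from h)
        exact hXl ⟨X', hX'⟩
      obtain ⟨x, hxX, hxV⟩ := hx
      obtain ⟨y, hyX, hyU⟩ := hy
      have hxU : x ∈ U := (Finset.mem_union.1 (hcUV i (hi' hxX))).resolve_right hxV
      obtain ⟨x, hxU1, rfl⟩ := Finset.mem_image.1 hxU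
      have hxS : x ∉ S := fun h => hxV (Finset.mem_image.2 ⟨x, hSV h, hjS x h⟩)
      have hlarge : ∀ k, X ⊆ c k → 2 ≤ (p1 k ∩ S).card := by
        intro k hk
        rcases (hp k).2.2.2.2 with h | h | h
        · omega
        · exact absurd (h ((hcl k x).1 (hk hxX))) hxS
        · rcases Finset.mem_union.1 (hk hyX) with h' | h'
          · exact absurd (Finset.image_subset_image (hp1U k) h') hyU
          · obtain ⟨b, hb, rfl⟩ := Finset.mem_image.1 h'
            rw [hjS b (h hb)] at hyU
            exact absurd (Finset.mem_image_of_mem _ (hSU (h hb))) hyU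
      exact hp1.eq_of_mem_of_strong hxS (hstrong1 {x} (by simpa using hxU1)) (hlarge i hi')
        (hlarge k hk') ((hcl i x).1 (hi' hxX)) ((hcl k x).1 (hk' hxX))
    calc _ ≤ 1 * (X.card - 2) := Nat.mul_le_mul_right _ hle
      _ ≤ X.card := by omega
  let D : SStruct (α ⊕ α) := SStruct.ofFamily (↑(U ∪ V)) c
    (fun i => Finset.coe_subset.2 (hcUV i)) hcard hvalid
  have hD : IsCliqueFamily D c := SStruct.isCliqueFamily_ofFamily _ _ _ _ _
  have hdi : ∀ X, d0s D (X.image Sum.inl) = d0s B1 X := hp1.d0s_image hD hi hcl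
  have hdj : ∀ X, d0s D (X.image j) = d0s B2 X := hp2.d0s_image hD hj hcj
  have hUD : ∀ X ⊆ U ∪ V, d0s D U ≤ d0s D (X ∪ U) := by
    refine fun X hX => hD.d0s_le_of_free_amalgam hfree (fun Z hZ => ?_) hX
    obtain ⟨Z', hZ', rfl⟩ := Finset.subset_image_iff.1 hZ
    rw [hUV, hSj, ← Finset.image_union, hdj, hdj]
    exact hstrong2 Z' hZ'
  have hVD : ∀ X ⊆ U ∪ V, d0s D V ≤ d0s D (X ∪ V) := by
    refine fun X hX => hD.d0s_le_of_free_amalgam (U := V) (V := U) (fun i => ?_)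
      (fun Z hZ => ?_) (by rwa [Finset.union_comm])
    · rw [Finset.inter_comm V U, or_comm (a := c i ⊆ V)]
      exact hfree i
    · obtain ⟨Z', hZ', rfl⟩ := Finset.subset_image_iff.1 hZ
      rw [Finset.inter_comm, hUV, ← Finset.image_union, hdi, hdi]
      exact hstrong1 Z' hZ'
  have hiU : Sum.inl '' B1.carrier = (U : Set (α ⊕ α)) := by rw [hU, Finset.coe_image, hU1]
  have hjV : j '' B2.carrier = (V : Set (α ⊕ α)) := by rw [hV, Finset.coe_image, hV1]
  have hiS : Sum.inl '' A.carrier = ((S.image Sum.inl : Finset (α ⊕ α)) : Set (α ⊕ α)) := by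
    rw [Finset.coe_image, hSA]
  have hUsub : (U : Set (α ⊕ α)) ⊆ D.carrier := Finset.coe_subset.2 Finset.subset_union_left
  have hVsub : (V : Set (α ⊕ α)) ⊆ D.carrier := Finset.coe_subset.2 Finset.subset_union_right
  have htrans : ∀ X ⊆ U ∪ V, d0s D (X ∩ U) ≤ d0s D X := fun X hX => hD.d0s_inter_le (hUD X hX)
  refine ⟨D, Sum.inl, j, ⟨(U ∪ V).finite_toSet, fun X hX => ?_⟩,
    ⟨hi.injOn, hiU ▸ hUsub, fun X _ hX => hp1.multFun_image hD hi hcl X hX⟩,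
    ⟨hj.injOn, hjV ▸ hVsub, fun X _ hX => hp2.multFun_image hD hj hcj X hX⟩,
    ⟨hiU ▸ hUsub, fun Y X hY hX => ?_⟩, ⟨hjV ▸ hVsub, fun Y X hY hX => ?_⟩,
    fun a ha => (hjS a (by rwa [← Finset.mem_coe, hSA])).symm,
    ⟨(Set.image_mono hsub1.1).trans (hiU ▸ hUsub), fun Y X hY hX => ?_⟩⟩
  · refine le_trans ?_ (htrans X (Finset.coe_subset.1 hX))
    obtain ⟨Z, hZ, hZX⟩ := Finset.subset_image_iff.1 (Finset.inter_subset_right : X ∩ U ⊆ U)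
    rw [← hZX, hdi]
    exact hB1.2 Z (by rw [← hU1]; exact_mod_cast hZ)
  · obtain rfl : Y = U := Finset.coe_injective (hY.trans hiU)
    exact hUD X (Finset.coe_subset.1 hX)
  · obtain rfl : Y = V := Finset.coe_injective (hY.trans hjV)
    exact hVD X (Finset.coe_subset.1 hX)
  · obtain rfl : Y = S.image Sum.inl := Finset.coe_injective (hY.trans hiS)
    have hYU : S.image Sum.inl ⊆ U := Finset.image_subset_image hSU
    refine le_trans ?_ (htrans (X ∪ S.image Sum.inl) (Finset.union_subset
      (Finset.coe_subset.1 hX) (hYU.trans Finset.subset_union_left)))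
    rw [Finset.union_inter_distrib_right, Finset.inter_eq_left.2 hYU]
    obtain ⟨Z, hZ, hZX⟩ := Finset.subset_image_iff.1 (Finset.inter_subset_right : X ∩ U ⊆ U)
    rw [← hZX, ← Finset.image_union, hdi, hdi]
    exact hstrong1 Z (by exact_mod_cast hZ)
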